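/- arXiv:2009.07178 — 2 statements merged into one kernel-verified Lean document; each statement's English description precedes it below -/
import Mathlib

section
/- Let ℓ, u be reals with 0 ≤ ℓ < u, let n ≥ 2 be an integer, and let 1 < p ≤ 2. Then the volume function V_p is strictly convex on the domain D (as a function of (ξ_1, …, ξ_{n−1})). -/
/-- The full sequence of linearization points: `ξ 0 = ℓ`, `ξ n = u`,
interior coordinates given by `x`. -/
noncomputable def xiSeq (l u : ℝ) (n : ℕ) (x : Fin (n - 1) → ℝ) (i : ℕ) : ℝ :=
  if h : 0 < i ∧ i < n then x ⟨i - 1, by omega⟩ else if i = 0 then l else u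

/-- The open domain `D = {ℓ < ξ₁ < ⋯ < ξ_{n-1} < u}`. -/
def domD (l u : ℝ) (n : ℕ) : Set (Fin (n - 1) → ℝ) :=
  {x | ∀ i < n, xiSeq l u n x i < xiSeq l u n x (i + 1)}

/-- The volume function `V_p` of the perspective relaxation of the piecewise-linear
under-estimator of `x^p` with linearization points `ℓ = ξ₀ < ξ₁ < ⋯ < ξ_n = u`. -/
noncomputable def Vp (l u p : ℝ) (n : ℕ) (x : Fin (n - 1) → ℝ) : ℝ :=
  -((p - 1) ^ 2 / (6 * p)) * ∑ i ∈ Finset.Icc 1 n,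
      (xiSeq l u n x (i - 1)) ^ (p - 1) * (xiSeq l u n x i) ^ (p - 1)
        * (xiSeq l u n x i - xiSeq l u n x (i - 1)) ^ 2
        / ((xiSeq l u n x i) ^ (p - 1) - (xiSeq l u n x (i - 1)) ^ (p - 1))
  + ((p - 1) / (6 * p)) * (u ^ (p + 1) - l ^ (p + 1)) - (1 / 6) * (u ^ p * l - u * l ^ p)


lemma vp_coef (r : ℝ) (h0 : 0 < r) (h1 : r ≤ 1) (n : ℕ) :
    (4*r^2+3*r+1)/2 ≤ (1+3*r) * r^(2*n+1) + (1-r)/2 * (1+2*r)^(2*n+1) := by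
  induction n with
  | zero => simp only [Nat.mul_zero, zero_add, pow_one]; nlinarith
  | succ n ih =>
    have e1 : r^(2*(n+1)+1) = r^(2*n+1) * r^2 := by ring
    have e2 : (1+2*r)^(2*(n+1)+1) = (1+2*r)^(2*n+1) * (1+2*r)^2 := by ring
    rw [e1, e2]
    have h2 : r^(2*n+1) ≤ r := by
      calc r^(2*n+1) ≤ r^1 := pow_le_pow_of_le_one h0.le h1 (by omega)
        _ = r := pow_one r
    have h3 : 1+2*r ≤ (1+2*r)^(2*n+1) := by
      calc 1+2*r = (1+2*r)^1 := (pow_one _).symm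
        _ ≤ _ := pow_le_pow_right₀ (by linarith) (by omega)
    generalize r^(2*n+1) = R at *
    generalize (1+2*r)^(2*n+1) = K at *
    have h4 : 0 ≤ 2*r*K - (1+3*r)*R := by
      have := mul_le_mul_of_nonneg_left h2 (by linarith : 0 ≤ 1+3*r)
      have := mul_le_mul_of_nonneg_left h3 (by linarith : 0 ≤ 2*r)
      nlinarith
    have h5 : 0 ≤ (1-r)*(1+r)*(2*r*K - (1+3*r)*R) :=
      mul_nonneg (mul_nonneg (by linarith) (by linarith)) h4
    nlinarith

lemma vp_sinh (r s : ℝ) (h0 : 0 < r) (h1 : r ≤ 1) (hs : 0 ≤ s) :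
    (4*r^2+3*r+1)/2 * Real.sinh s ≤
      (1+3*r) * Real.sinh (r*s) + (1-r)/2 * Real.sinh ((1+2*r)*s) := by
  refine hasSum_le (fun n => ?_) ((Real.hasSum_sinh s).mul_left _)
    (((Real.hasSum_sinh (r*s)).mul_left _).add ((Real.hasSum_sinh ((1+2*r)*s)).mul_left _))
  have h := vp_coef r h0 h1 n
  have hp : 0 ≤ s^(2*n+1) / ((2*n+1).factorial : ℝ) := by positivity
  have := mul_le_mul_of_nonneg_right h hp
  rw [mul_pow, mul_pow]
  calc _ ≤ _ := this
    _ = _ := by ring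

lemma vp_sinh2 (r s : ℝ) (h0 : 0 < r) (h1 : r ≤ 1) (hs : 0 ≤ s) :
    r^2*(3+r)*(Real.sinh s)^2 ≤ (1+3*r)*(Real.sinh (r*s))^2 +
      2*r*(1-r)*Real.sinh (r*s) * Real.sinh s * Real.cosh (r*s+s) := by
  have h := vp_sinh r s h0 h1 hs
  have e : Real.sinh ((1+2*r)*s) =
      2 * Real.sinh (r*s) * Real.cosh (r*s+s) + Real.sinh s := by
    have e1 : (1+2*r)*s = r*s + (r*s+s) := by ring
    have e2 : s = (r*s+s) - r*s := by ring
    have h1 := Real.sinh_add (r*s) (r*s+s)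
    have h2 := Real.sinh_sub (r*s+s) (r*s)
    rw [← e1] at h1
    rw [← e2] at h2
    rw [h1, h2]; ring
  rw [e] at h
  have hB : 0 ≤ Real.sinh s := Real.sinh_nonneg_iff.2 hs
  generalize Real.sinh s = B at *
  generalize Real.sinh (r*s) = A at *
  generalize Real.cosh (r*s+s) = C at *
  have h2 := mul_le_mul_of_nonneg_right h (mul_nonneg h0.le hB)
  have h3 : 0 ≤ (1+3*r)*(A-r*B)^2 := by positivity
  nlinarith

lemma vp_key (r a b : ℝ) (h0 : 0 < r) (h1 : r ≤ 1) (ha : 0 < a) (hab : a < b) :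
    4*r*(r*(a^r*b^r)*(b-a)^2 - a*b*(b^r-a^r)^2) ≤
      (1-r)*(b*(b^r-a^r)+r*a^r*(b-a))*(a*(b^r-a^r)+r*b^r*(b-a)) := by
  have hb : 0 < b := ha.trans hab
  obtain ⟨s, hs⟩ : ∃ s, s = Real.log (b/a) / 2 := ⟨_, rfl⟩
  have hs0 : 0 ≤ s := by
    rw [hs]; have := Real.log_nonneg ((one_le_div ha).2 hab.le); linarith
  have hbe : b = a * (Real.exp s)^2 := by
    rw [← Real.exp_nat_mul, hs]
    push_cast
    rw [mul_div_cancel₀ _ (two_ne_zero), Real.exp_log (by positivity)]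
    field_simp
  have hQ : b^r = a^r * (Real.exp (r*s))^2 := by
    rw [hbe, Real.mul_rpow ha.le (by positivity), ← Real.exp_nat_mul, ← Real.exp_nat_mul,
      ← Real.exp_mul]
    congr 2; ring
  have h := vp_sinh2 r s h0 h1 hs0
  rw [Real.sinh_eq, Real.sinh_eq, Real.cosh_eq, Real.exp_neg, Real.exp_neg, Real.exp_neg,
    Real.exp_add] at h
  rw [hQ]
  have hP : 0 < a^r := by positivity
  have he : 0 < Real.exp s := Real.exp_pos _
  have hE : 0 < Real.exp (r*s) := Real.exp_pos _
  generalize a^r = P at *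
  generalize Real.exp s = e at *
  generalize Real.exp (r*s) = E at *
  subst hbe
  rw [← sub_nonneg] at h ⊢
  have h2 := mul_nonneg (by positivity : 0 ≤ 4*a^2*P^2*e^2*E^2) h
  refine h2.trans_eq ?_
  field_simp
  ring

lemma vp_tangent (r v : ℝ) (h0 : 0 < r) (hv : 0 < v) (hv1 : v ≠ 1) :
    1 - r*(v-1) < v^(-r) := by
  rw [Real.rpow_def_of_pos hv]
  have h1 := Real.log_lt_sub_one_of_pos hv hv1
  have h2 := Real.add_one_le_exp (Real.log v * -r)
  nlinarith

lemma vp_lam1 (r a b : ℝ) (h0 : 0 < r) (ha : 0 < a) (hab : a < b) :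
    a*(b^r-a^r) < r*b^r*(b-a) := by
  have hb : 0 < b := ha.trans hab
  have h := vp_tangent r (b/a) h0 (by positivity) (by rw [Ne, div_eq_one_iff_eq ha.ne']; exact hab.ne')
  rw [Real.rpow_neg (by positivity), Real.div_rpow hb.le ha.le] at h
  have hP : 0 < a^r := by positivity
  have hQ : 0 < b^r := by positivity
  generalize a^r = P at *
  generalize b^r = Q at *
  have h2 := mul_lt_mul_of_pos_right h (by positivity : 0 < a*Q)
  have e1 : (Q/P)⁻¹ * (a*Q) = a*P := by field_simp
  have e2 : (1 - r*(b/a-1))*(a*Q) = a*Q - r*(b-a)*Q := by field_simp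
  nlinarith

lemma vp_lam2 (r a b : ℝ) (h0 : 0 < r) (ha : 0 < a) (hab : a < b) :
    r*a^r*(b-a) < b*(b^r-a^r) := by
  have hb : 0 < b := ha.trans hab
  have h := vp_tangent r (a/b) h0 (by positivity) (by rw [Ne, div_eq_one_iff_eq hb.ne']; exact hab.ne)
  rw [Real.rpow_neg (by positivity), Real.div_rpow ha.le hb.le] at h
  have hP : 0 < a^r := by positivity
  have hQ : 0 < b^r := by positivity
  generalize a^r = P at *
  generalize b^r = Q at *
  have h2 := mul_lt_mul_of_pos_right h (by positivity : 0 < b*P)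
  have e1 : (P/Q)⁻¹ * (b*P) = b*Q := by field_simp
  have e2 : (1 - r*(a/b-1))*(b*P) = b*P - r*(a-b)*P := by field_simp
  nlinarith

/-- Schur-complement inequality. -/
lemma vp_schur (r a b P Q L : ℝ) (h0 : 0 < r) (h1 : r ≤ 1) (ha : 0 < a) (hab : a < b)
    (hP : 0 < P) (hPQ : P < Q) (hL : L = r*P*Q*(b-a)/(Q-P))
    (key : 4*r*(r*(P*Q)*(b-a)^2 - a*b*(Q-P)^2) ≤
      (1-r)*(b*(Q-P)+r*P*(b-a))*(a*(Q-P)+r*Q*(b-a))) :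
    2*(L/(b-a)) * ((b*Q-L)/(b*Q) * (b/(b*Q+L)) + (L-a*P)/(a*P)*(a/(a*P+L))) ≤ r+1 := by
  have hb : 0 < b := ha.trans hab
  have hQ : 0 < Q := hP.trans hPQ
  have hk : 0 < Q - P := by linarith
  have hm : 0 < b - a := by linarith
  have hLpos : 0 < L := by rw [hL]; positivity
  have e1 : (b*Q-L)/(b*Q) * (b/(b*Q+L)) = 2*(b/(b*Q+L)) - 1/Q := by field_simp; ring
  have e2 : (L-a*P)/(a*P)*(a/(a*P+L)) = 1/P - 2*(a/(a*P+L)) := by field_simp; ring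
  have e3 : 1/P - 1/Q = r*(b-a)/L := by rw [hL]; field_simp
  have main : b/(b*Q+L) - a/(a*P+L) ≤ (1-r)*(b-a)/(4*L) := by
    rw [div_sub_div _ _ (by positivity) (by positivity), div_le_div_iff₀ (by positivity) (by positivity)]
    have f1 : b*Q+L = Q*(b*(Q-P)+r*P*(b-a))/(Q-P) := by rw [hL]; field_simp
    have f2 : a*P+L = P*(a*(Q-P)+r*Q*(b-a))/(Q-P) := by rw [hL]; field_simp
    rw [← sub_nonneg] at key ⊢
    have h2 := mul_nonneg (by positivity : 0 ≤ P*Q*(b-a)/(Q-P)^2) key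
    refine h2.trans_eq ?_
    rw [f1, f2, hL]
    field_simp
    ring
  rw [e1, e2]
  have e4 : 2*(b/(b*Q+L)) - 1/Q + (1/P - 2*(a/(a*P+L))) ≤ (r+1)*(b-a)/(2*L) := by
    have : (r+1)*(b-a)/(2*L) = r*(b-a)/L + 2*((1-r)*(b-a)/(4*L)) := by field_simp; ring
    rw [this, ← e3]; linarith
  have := mul_le_mul_of_nonneg_left e4 (by positivity : 0 ≤ 2*(L/(b-a)))
  refine this.trans_eq ?_
  field_simp

lemma vp_cs (x y m n c k u w : ℝ) (hx : 0 < x) (hy : 0 < y) (hm : 0 < m) (hn : 0 < n)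
    (hc : 0 < c) (h : c*(x*(1/m) + y*(1/n)) ≤ k) :
    c*(x*u+y*w)^2 ≤ k*(x*m*u^2+y*n*w^2) := by
  have h1 : (x*u+y*w)^2 ≤ (x*(1/m) + y*(1/n)) * (x*m*u^2+y*n*w^2) := by
    rw [← sub_nonneg]
    have : 0 ≤ x*y*(m*u-n*w)^2/(m*n) := by positivity
    refine this.trans_eq ?_
    field_simp; ring
  have h2 : 0 ≤ x*m*u^2+y*n*w^2 := by positivity
  nlinarith [mul_le_mul_of_nonneg_right h h2, mul_le_mul_of_nonneg_left h1 hc.le]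

lemma vp_cs_strict (x y m n c k u : ℝ) (hx : 0 < x) (hy : 0 < y) (hm : 0 < m) (hn : 0 < n)
    (hc : 0 < c) (hu : u ≠ 0) (h : c*(x*(1/m) + y*(1/n)) ≤ k) :
    c*(x*u)^2 < k*(x*m*u^2) := by
  have h1 : c*(x*(1/m)) < k := by
    have : 0 < c*(y*(1/n)) := by positivity
    nlinarith
  have h2 : 0 < x*m*u^2 := by positivity
  have := mul_lt_mul_of_pos_right h1 h2
  refine lt_of_eq_of_lt ?_ this
  field_simp

/-- second derivative expression -/
noncomputable def vpSecond (r a b u w : ℝ) : ℝ :=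
  (r+1)/r*(b^r*u^2-a^r*w^2) -
   (2*(u-w)^2/(a^(-r)-b^(-r)) - 4*(b-a)*(u-w)*(r*(b^(-r-1)*u-a^(-r-1)*w))/(a^(-r)-b^(-r))^2
    + 2*(b-a)^2*(r*(b^(-r-1)*u-a^(-r-1)*w))^2/(a^(-r)-b^(-r))^3
    - (b-a)^2*(r*(r+1)*(a^(-r-2)*w^2-b^(-r-2)*u^2))/(a^(-r)-b^(-r))^2)

lemma vpSecond_eq (r a b u w L : ℝ) (h0 : 0 < r) (ha : 0 < a) (hab : a < b)
    (hL : L = r*a^r*b^r*(b-a)/(b^r-a^r)) :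
    vpSecond r a b u w = ((r+1)*((b*b^r-L)/(b*b^r)*((b*b^r+L)/b)*u^2
      + (L-a*a^r)/(a*a^r)*((a*a^r+L)/a)*w^2)
      - 2*(L/(b-a))*((b*b^r-L)/(b*b^r)*u + (L-a*a^r)/(a*a^r)*w)^2)/r := by
  have hb : 0 < b := ha.trans hab
  have hP : 0 < a^r := by positivity
  have hPQ : a^r < b^r := Real.rpow_lt_rpow ha.le hab h0
  have e (x : ℝ) (hx : 0 < x) : x^(-r) = 1/x^r ∧ x^(-r-1) = 1/(x^r*x) ∧
      x^(-r-2) = 1/(x^r*x^2) := by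
    refine ⟨?_, ?_, ?_⟩
    · rw [Real.rpow_neg hx.le, one_div]
    · rw [Real.rpow_sub_one hx.ne', Real.rpow_neg hx.le]; field_simp
    · have : (-r-2) = -r-1-1 := by ring
      rw [this, Real.rpow_sub_one hx.ne', Real.rpow_sub_one hx.ne', Real.rpow_neg hx.le]; field_simp
  obtain ⟨a1, a2, a3⟩ := e a ha
  obtain ⟨b1, b2, b3⟩ := e b hb
  unfold vpSecond
  rw [a1, a2, a3, b1, b2, b3]
  generalize a^r = P at *
  generalize b^r = Q at *
  have hQ : 0 < Q := hP.trans hPQ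
  have hk : 0 < Q - P := by linarith
  have hm : 0 < b - a := by linarith
  have ey : 1/P - 1/Q = (Q-P)/(P*Q) := by field_simp
  rw [ey, hL]
  generalize hkk : Q - P = k at *
  generalize hmm : b - a = m at *
  field_simp
  ring

lemma vpSecond_nonneg (r a b u w : ℝ) (h0 : 0 < r) (h1 : r ≤ 1) (ha : 0 < a) (hab : a < b) :
    0 ≤ vpSecond r a b u w ∧ (w = 0 → u ≠ 0 → 0 < vpSecond r a b u w) := by
  have hb : 0 < b := ha.trans hab
  have hP : 0 < a^r := by positivity
  have hPQ : a^r < b^r := Real.rpow_lt_rpow ha.le hab h0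
  have key := vp_key r a b h0 h1 ha hab
  have l1 := vp_lam1 r a b h0 ha hab
  have l2 := vp_lam2 r a b h0 ha hab
  obtain ⟨L, hL⟩ : ∃ L, L = r*a^r*b^r*(b-a)/(b^r-a^r) := ⟨_, rfl⟩
  rw [vpSecond_eq r a b u w L h0 ha hab hL]
  have sch := vp_schur r a b _ _ L h0 h1 ha hab hP hPQ hL key
  generalize a^r = P at *
  generalize b^r = Q at *
  have hQ : 0 < Q := hP.trans hPQ
  have hk : 0 < Q - P := by linarith
  have hm : 0 < b - a := by linarith
  have hLpos : 0 < L := by rw [hL]; positivity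
  have L1 : 0 < L - a*P := by
    rw [hL, sub_pos, lt_div_iff₀ hk]; nlinarith
  have L2 : 0 < b*Q - L := by
    rw [hL, sub_pos, div_lt_iff₀ hk]; nlinarith
  have hx : 0 < (b*Q-L)/(b*Q) := by positivity
  have hy : 0 < (L-a*P)/(a*P) := by positivity
  have hM : 0 < (b*Q+L)/b := by positivity
  have hN : 0 < (a*P+L)/a := by positivity
  have hc : 0 < 2*(L/(b-a)) := by positivity
  rw [← one_div_div (b*Q+L) b, ← one_div_div (a*P+L) a] at sch
  constructor
  · have := vp_cs _ _ _ _ _ _ u w hx hy hM hN hc sch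
    apply div_nonneg _ h0.le
    linarith
  · intro hw hu
    have := vp_cs_strict _ _ _ _ _ _ u hx hy hM hN hc hu sch
    apply div_pos _ h0
    subst hw
    simp only [mul_zero, add_zero, ne_eq, OfNat.ofNat_ne_zero, not_false_eq_true, zero_pow]
    linarith

noncomputable def vpG (r a b : ℝ) : ℝ :=
  (b^(r+2)-a^(r+2))/(r*(r+2)) - a^r*b^r*(b-a)^2/(b^r-a^r)

noncomputable def vpH (r a b : ℝ) : ℝ :=
  (b^(r+2)-a^(r+2))/(r*(r+2)) - (b-a)^2/(a^(-r)-b^(-r))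

noncomputable def vpFirst (r a b u w : ℝ) : ℝ :=
  (b^(r+1)*u-a^(r+1)*w)/r - (2*(b-a)*(u-w)/(a^(-r)-b^(-r))
    - (b-a)^2*(r*(b^(-r-1)*u-a^(-r-1)*w))/(a^(-r)-b^(-r))^2)

lemma vpG_eq_vpH (r a b : ℝ) (h0 : 0 < r) (ha : 0 < a) (hab : a < b) :
    vpG r a b = vpH r a b := by
  have hb : 0 < b := ha.trans hab
  have hPQ : a^r < b^r := Real.rpow_lt_rpow ha.le hab h0
  have hP : 0 < a^r := by positivity
  have hQ : 0 < b^r := by positivity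
  unfold vpG vpH
  rw [Real.rpow_neg ha.le, Real.rpow_neg hb.le]
  have e : (a^r)⁻¹ - (b^r)⁻¹ = (b^r-a^r)/(a^r*b^r) := by field_simp
  rw [e]
  congr 1
  have : 0 < b^r - a^r := by linarith
  field_simp

lemma vp_y_pos (r a b : ℝ) (h0 : 0 < r) (ha : 0 < a) (hab : a < b) :
    0 < a^(-r)-b^(-r) := by
  have := Real.rpow_lt_rpow_of_neg ha hab (by linarith : -r < 0)
  linarith

lemma vp_deriv1 (r : ℝ) (h0 : 0 < r) (A B : ℝ → ℝ) (w u t : ℝ) (hA : HasDerivAt A w t)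
    (hB : HasDerivAt B u t) (ha : 0 < A t) (hab : A t < B t) :
    HasDerivAt (fun t => vpH r (A t) (B t)) (vpFirst r (A t) (B t) u w) t := by
  have hb : 0 < B t := ha.trans hab
  have hy := vp_y_pos r _ _ h0 ha hab
  have d1 := ((hB.rpow_const (p := r+2) (Or.inl hb.ne')).sub
    (hA.rpow_const (p := r+2) (Or.inl ha.ne'))).div_const (r*(r+2))
  have d2 := (hA.rpow_const (p := -r) (Or.inl ha.ne')).sub
    (hB.rpow_const (p := -r) (Or.inl hb.ne'))
  have d3 := ((hB.sub hA).pow 2).div d2 hy.ne'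
  have d := d1.sub d3
  refine d.congr_deriv ?_
  have e : r + 2 - 1 = r + 1 := by ring
  unfold vpFirst
  simp only [e, Pi.sub_apply, Pi.pow_apply]
  generalize A t ^ (-r) - B t ^ (-r) = y at *
  have : r+2 ≠ 0 := by positivity
  field_simp
  push_cast
  ring

lemma vp_deriv2 (r : ℝ) (h0 : 0 < r) (A B : ℝ → ℝ) (w u t : ℝ) (hA : HasDerivAt A w t)
    (hB : HasDerivAt B u t) (ha : 0 < A t) (hab : A t < B t) :
    HasDerivAt (fun t => vpFirst r (A t) (B t) u w) (vpSecond r (A t) (B t) u w) t := by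
  have hb : 0 < B t := ha.trans hab
  have hy := vp_y_pos r _ _ h0 ha hab
  have d1 := (((hB.rpow_const (p := r+1) (Or.inl hb.ne')).mul_const u).sub
    ((hA.rpow_const (p := r+1) (Or.inl ha.ne')).mul_const w)).div_const r
  have d2 := (hA.rpow_const (p := -r) (Or.inl ha.ne')).sub
    (hB.rpow_const (p := -r) (Or.inl hb.ne'))
  have d3 := (((hB.sub hA).const_mul 2).mul_const (u-w)).div d2 hy.ne'
  have d4 := (((hB.rpow_const (p := -r-1) (Or.inl hb.ne')).mul_const u).sub
    ((hA.rpow_const (p := -r-1) (Or.inl ha.ne')).mul_const w)).const_mul r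
  have d5 := (((hB.sub hA).pow 2).mul d4).div (d2.pow 2) (pow_ne_zero 2 hy.ne')
  have d := d1.sub (d3.sub d5)
  refine d.congr_deriv ?_
  have e : r + 1 - 1 = r := by ring
  have e2 : -r - 1 - 1 = -r-2 := by ring
  unfold vpSecond
  simp only [e, e2, Pi.sub_apply, Pi.pow_apply, Pi.mul_apply]
  generalize A t ^ (-r) - B t ^ (-r) = y at *
  field_simp
  push_cast
  ring

lemma vp_segment (r a0 b0 a1 b1 : ℝ) (h0 : 0 < r) (h1 : r ≤ 1) (ha0 : 0 < a0) (hab0 : a0 < b0)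
    (ha1 : 0 < a1) (hab1 : a1 < b1) :
    ConvexOn ℝ (Set.Icc 0 1) (fun t => vpH r (a0+t*(a1-a0)) (b0+t*(b1-b0))) ∧
    (a0 = a1 → b0 ≠ b1 →
      StrictConvexOn ℝ (Set.Icc 0 1) (fun t => vpH r (a0+t*(a1-a0)) (b0+t*(b1-b0)))) := by
  have dA (t : ℝ) : HasDerivAt (fun t => a0+t*(a1-a0)) (a1-a0) t := by
    simpa using ((hasDerivAt_id t).mul_const (a1-a0)).const_add a0
  have dB (t : ℝ) : HasDerivAt (fun t => b0+t*(b1-b0)) (b1-b0) t := by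
    simpa using ((hasDerivAt_id t).mul_const (b1-b0)).const_add b0
  have pA (t : ℝ) (ht : t ∈ Set.Icc (0:ℝ) 1) : 0 < a0+t*(a1-a0) := by
    obtain ⟨h, h'⟩ := ht
    rcases h.eq_or_lt with h | h
    · subst h; simpa using ha0
    · nlinarith [mul_pos h ha1, mul_nonneg (sub_nonneg.2 h') ha0.le]
  have pB (t : ℝ) (ht : t ∈ Set.Icc (0:ℝ) 1) : a0+t*(a1-a0) < b0+t*(b1-b0) := by
    obtain ⟨h, h'⟩ := ht
    rcases h.eq_or_lt with h | h
    · subst h; simpa using hab0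
    · nlinarith [mul_pos h (sub_pos.2 hab1), mul_nonneg (sub_nonneg.2 h') (sub_pos.2 hab0).le]
  have D1 (t : ℝ) (ht : t ∈ Set.Icc (0:ℝ) 1) :=
    vp_deriv1 r h0 _ _ _ _ t (dA t) (dB t) (pA t ht) (pB t ht)
  have D2 (t : ℝ) (ht : t ∈ Set.Icc (0:ℝ) 1) :=
    vp_deriv2 r h0 _ _ _ _ t (dA t) (dB t) (pA t ht) (pB t ht)
  have cont : ContinuousOn (fun t => vpH r (a0+t*(a1-a0)) (b0+t*(b1-b0))) (Set.Icc 0 1) :=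
    fun t ht => (D1 t ht).continuousAt.continuousWithinAt
  constructor
  · refine convexOn_of_hasDerivWithinAt2_nonneg (convex_Icc 0 1) cont
      (fun t ht => (D1 t (interior_subset ht)).hasDerivWithinAt)
      (fun t ht => (D2 t (interior_subset ht)).hasDerivWithinAt)
      (fun t ht => (vpSecond_nonneg r _ _ _ _ h0 h1 (pA t (interior_subset ht))
        (pB t (interior_subset ht))).1)
  · intro haa hbb
    refine strictConvexOn_of_deriv2_pos (convex_Icc 0 1) cont ?_
    intro t ht
    have ht' := interior_subset ht
    have ev : deriv (fun t => vpH r (a0+t*(a1-a0)) (b0+t*(b1-b0))) =ᶠ[nhds t]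
        (fun t => vpFirst r (a0+t*(a1-a0)) (b0+t*(b1-b0)) (b1-b0) (a1-a0)) := by
      filter_upwards [isOpen_interior.mem_nhds ht] with x hx
      exact (D1 x (interior_subset hx)).deriv
    have : (deriv^[2] (fun t => vpH r (a0+t*(a1-a0)) (b0+t*(b1-b0)))) t =
        vpSecond r (a0+t*(a1-a0)) (b0+t*(b1-b0)) (b1-b0) (a1-a0) := by
      simp only [Function.iterate_succ, Function.iterate_zero, Function.comp, id]
      rw [ev.deriv_eq]
      exact (D2 t ht').deriv
    rw [this]
    exact (vpSecond_nonneg r _ _ _ _ h0 h1 (pA t ht') (pB t ht')).2 (by linarith)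
      (by intro h; apply hbb; linarith)

lemma vpG_convex (r a0 b0 a1 b1 s t : ℝ) (h0 : 0 < r) (h1 : r ≤ 1) (ha0 : 0 < a0) (hab0 : a0 < b0)
    (ha1 : 0 < a1) (hab1 : a1 < b1) (hs : 0 < s) (ht : 0 < t) (hst : s + t = 1) :
    vpG r (s*a0+t*a1) (s*b0+t*b1) ≤ s * vpG r a0 b0 + t * vpG r a1 b1 ∧
    (a0 = a1 → b0 ≠ b1 →
      vpG r (s*a0+t*a1) (s*b0+t*b1) < s * vpG r a0 b0 + t * vpG r a1 b1) := by
  obtain ⟨hc, hc'⟩ := vp_segment r a0 b0 a1 b1 h0 h1 ha0 hab0 ha1 hab1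
  have ea : s*a0+t*a1 = a0+t*(a1-a0) := by
    have : s = 1 - t := by linarith
    rw [this]; ring
  have eb : s*b0+t*b1 = b0+t*(b1-b0) := by
    have : s = 1 - t := by linarith
    rw [this]; ring
  have m0 : (0:ℝ) ∈ Set.Icc (0:ℝ) 1 := by simp
  have m1 : (1:ℝ) ∈ Set.Icc (0:ℝ) 1 := by simp
  have pa : 0 < s*a0+t*a1 := by positivity
  have pb : s*a0+t*a1 < s*b0+t*b1 := by
    have := mul_lt_mul_of_pos_left hab0 hs
    have := mul_lt_mul_of_pos_left hab1 ht
    linarith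
  rw [vpG_eq_vpH r _ _ h0 pa pb, vpG_eq_vpH r _ _ h0 ha0 hab0, vpG_eq_vpH r _ _ h0 ha1 hab1, ea, eb]
  constructor
  · have := hc.2 m0 m1 hs.le ht.le hst
    simpa using this
  · intro haa hbb
    have := (hc' haa hbb).2 m0 m1 zero_ne_one hs ht hst
    simpa using this

lemma vpG_zero (r b0 b1 s t : ℝ) (h0 : 0 < r) (hb0 : 0 < b0) (hb1 : 0 < b1)
    (hs : 0 < s) (ht : 0 < t) (hst : s + t = 1) (hne : b0 ≠ b1) :
      vpG r 0 (s*b0+t*b1) < s * vpG r 0 b0 + t * vpG r 0 b1 := by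
  have h := (strictConvexOn_rpow (by linarith : 1 < r+2)).2 (Set.mem_Ici.2 hb0.le)
    (Set.mem_Ici.2 hb1.le) hne hs ht hst
  have hr : 0 < r*(r+2) := by positivity
  have e (b : ℝ) : vpG r 0 b = b^(r+2)/(r*(r+2)) := by
    unfold vpG
    rw [Real.zero_rpow (by positivity), Real.zero_rpow (by positivity)]
    simp
  rw [e, e, e, ← mul_div_assoc, ← mul_div_assoc, ← add_div]
  exact div_lt_div_of_pos_right (by simpa using h) hr

/-- first piece -/
lemma vpG_first (r a b0 b1 s t : ℝ) (h0 : 0 < r) (h1 : r ≤ 1) (ha : 0 ≤ a) (hb0 : a < b0)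
    (hb1 : a < b1)
    (hs : 0 < s) (ht : 0 < t) (hst : s + t = 1) (hne : b0 ≠ b1) :
      vpG r a (s*b0+t*b1) < s * vpG r a b0 + t * vpG r a b1 := by
  rcases ha.eq_or_lt with h | h
  · subst h
    exact vpG_zero r b0 b1 s t h0 hb0 hb1 hs ht hst hne
  · have := (vpG_convex r a b0 a b1 s t h0 h1 h hb0 h hb1 hs ht hst).2 rfl hne
    have e : s*a+t*a = a := by rw [← add_mul, hst, one_mul]
    rwa [e] at this

lemma xiSeq_comb (l u : ℝ) (n : ℕ) (x y : Fin (n-1) → ℝ) (s t : ℝ) (hst : s + t = 1) (i : ℕ) :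
    xiSeq l u n (s • x + t • y) i = s * xiSeq l u n x i + t * xiSeq l u n y i := by
  unfold xiSeq
  split_ifs
  · simp
  · rw [← add_mul, hst, one_mul]
  · rw [← add_mul, hst, one_mul]

lemma xiSeq_zero (l u : ℝ) (n : ℕ) (x : Fin (n-1) → ℝ) : xiSeq l u n x 0 = l := by
  simp [xiSeq]

lemma xiSeq_last (l u : ℝ) (n : ℕ) (hn : 2 ≤ n) (x : Fin (n-1) → ℝ) : xiSeq l u n x n = u := by
  unfold xiSeq
  rw [dif_neg (by omega), if_neg (by omega)]

lemma xiSeq_pos (l u : ℝ) (hl : 0 ≤ l) (n : ℕ) (x : Fin (n-1) → ℝ) (hx : x ∈ domD l u n)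
    (i : ℕ) (hi : i < n) : 0 < xiSeq l u n x (i+1) := by
  induction i with
  | zero =>
    have := hx 0 hi
    rw [xiSeq_zero] at this
    linarith
  | succ i ih => exact (ih (by omega)).trans (hx (i+1) hi)

lemma Vp_eq (l u p : ℝ) (n : ℕ) (hn : 2 ≤ n) (hp : 1 < p) (x : Fin (n-1) → ℝ) :
    Vp l u p n x = (p-1)^2/(6*p) *
      (∑ i ∈ Finset.range n, vpG (p-1) (xiSeq l u n x i) (xiSeq l u n x (i+1)))
      + (-((p-1)^2/(6*p)) * ((u^(p+1)-l^(p+1))/((p-1)*(p+1)))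
      + ((p - 1) / (6 * p)) * (u ^ (p + 1) - l ^ (p + 1)) - (1 / 6) * (u ^ p * l - u * l ^ p)) := by
  have e : p - 1 + 2 = p + 1 := by ring
  unfold vpG
  rw [Finset.sum_sub_distrib, ← Finset.sum_div, e,
    Finset.sum_range_sub (fun i => (xiSeq l u n x i)^(p+1)), xiSeq_zero, xiSeq_last l u n hn]
  unfold Vp
  rw [← Finset.Ico_add_one_right_eq_Icc, Finset.sum_Ico_eq_sum_range]
  simp only [Nat.add_sub_cancel, Nat.add_sub_cancel_left, add_comm 1]
  ring

lemma vp_domD_convex (l u : ℝ) (n : ℕ) : Convex ℝ (domD l u n) := by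
  rw [convex_iff_forall_pos]
  intro x hx y hy s t hs ht hst i hi
  rw [xiSeq_comb _ _ _ _ _ _ _ hst, xiSeq_comb _ _ _ _ _ _ _ hst]
  have := mul_lt_mul_of_pos_left (hx i hi) hs
  have := mul_lt_mul_of_pos_left (hy i hi) ht
  linarith

/-- For `1 < p ≤ 2`, the volume function `V_p` is strictly convex on `D`. -/
theorem Vp_strictConvexOn_of_p_le_two
    (l u : ℝ) (hl : 0 ≤ l) (hlu : l < u) (n : ℕ) (hn : 2 ≤ n)
    (p : ℝ) (hp1 : 1 < p) (hp2 : p ≤ 2) :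
    StrictConvexOn ℝ (domD l u n) (Vp l u p n) := by
  refine ⟨vp_domD_convex l u n, ?_⟩
  intro x hx y hy hxy s t hs ht hst
  have h0 : 0 < p - 1 := by linarith
  have h1 : p - 1 ≤ 1 := by linarith
  -- first index at which the two sequences differ
  have hex : ∃ i, i < n ∧ xiSeq l u n x (i+1) ≠ xiSeq l u n y (i+1) := by
    by_contra! hcon
    apply hxy
    funext j
    have hj := j.2
    have := hcon j.1 (by omega)
    unfold xiSeq at this
    rw [dif_pos (by omega), dif_pos (by omega)] at this
    simpa using this
  classical
  have hfirst := Nat.find_spec hex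
  have hmin := fun m => @Nat.find_min _ _ hex m
  generalize Nat.find hex = k at hfirst hmin
  obtain ⟨hk, hkne⟩ := hfirst
  have hkeq : xiSeq l u n x k = xiSeq l u n y k := by
    rcases k with _ | k
    · rw [xiSeq_zero, xiSeq_zero]
    · by_contra hne
      exact hmin k (by omega) ⟨by omega, hne⟩
  have strict : ∀ i < n, xiSeq l u n x i = xiSeq l u n y i →
      xiSeq l u n x (i+1) ≠ xiSeq l u n y (i+1) →
      vpG (p-1) (xiSeq l u n (s • x + t • y) i) (xiSeq l u n (s • x + t • y) (i+1)) <
      s * vpG (p-1) (xiSeq l u n x i) (xiSeq l u n x (i+1)) +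
      t * vpG (p-1) (xiSeq l u n y i) (xiSeq l u n y (i+1)) := by
    intro i hi heq hne
    have hxi := hx i hi
    have hyi := hy i hi
    have hpos : 0 ≤ xiSeq l u n y i := by
      rcases i with _ | i
      · rw [xiSeq_zero]; exact hl
      · exact (xiSeq_pos l u hl n y hy i (by omega)).le
    rw [xiSeq_comb _ _ _ _ _ _ _ hst, xiSeq_comb _ _ _ _ _ _ _ hst]
    rw [heq] at hxi ⊢
    rw [← add_mul, hst, one_mul]
    exact vpG_first (p-1) _ _ _ s t h0 h1 hpos hxi hyi hs ht hst hne
  have weak : ∀ i < n,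
      vpG (p-1) (xiSeq l u n (s • x + t • y) i) (xiSeq l u n (s • x + t • y) (i+1)) ≤
      s * vpG (p-1) (xiSeq l u n x i) (xiSeq l u n x (i+1)) +
      t * vpG (p-1) (xiSeq l u n y i) (xiSeq l u n y (i+1)) := by
    intro i hi
    rcases i with _ | i
    · by_cases hne : xiSeq l u n x (0+1) = xiSeq l u n y (0+1)
      · rw [xiSeq_comb _ _ _ _ _ _ _ hst, xiSeq_comb _ _ _ _ _ _ _ hst, hne, xiSeq_zero,
          xiSeq_zero, ← add_mul, ← add_mul, ← add_mul, hst, one_mul, one_mul, one_mul]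
      · exact (strict 0 hi (by rw [xiSeq_zero, xiSeq_zero]) hne).le
    · rw [xiSeq_comb _ _ _ _ _ _ _ hst, xiSeq_comb _ _ _ _ _ _ _ hst]
      exact (vpG_convex (p-1) _ _ _ _ s t h0 h1 (xiSeq_pos l u hl n x hx i (by omega))
        (hx _ hi) (xiSeq_pos l u hl n y hy i (by omega)) (hy _ hi) hs ht hst).1
  have hsum := Finset.sum_lt_sum (fun i hi => weak i (Finset.mem_range.1 hi))
    ⟨k, Finset.mem_range.2 hk, strict k hk hkeq hkne⟩
  rw [Finset.sum_add_distrib, ← Finset.mul_sum, ← Finset.mul_sum] at hsum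
  rw [Vp_eq l u p n hn hp1, Vp_eq l u p n hn hp1, Vp_eq l u p n hn hp1]
  have hc : 0 < (p-1)^2/(6*p) := by positivity
  have := mul_lt_mul_of_pos_left hsum hc
  simp only [smul_eq_mul]
  generalize (-((p-1)^2/(6*p)) * ((u^(p+1)-l^(p+1))/((p-1)*(p+1)))
      + ((p - 1) / (6 * p)) * (u ^ (p + 1) - l ^ (p + 1))
      - (1 / 6) * (u ^ p * l - u * l ^ p)) = c
  have hcc : c = s*c + t*c := by rw [← add_mul, hst, one_mul]
  linarith
end

section
/- Let ℓ, u be reals with 0 ≤ ℓ < u, let n ≥ 2 be an integer, and let p > 2. Then there exists a unique ξ = (ξ_1, …, ξ_{n−1}) ∈ D such that F_i(ξ) = 0 for all i = 1, …, n−1. -/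
/-- The stationarity map `F = (F_1, …, F_{n-1})`: here the coordinate `j : Fin (n-1)`
corresponds to the index `i = j + 1 ∈ {1, …, n-1}` of the paper. -/
noncomputable def Fmap (l u p : ℝ) (n : ℕ) (x : Fin (n - 1) → ℝ) (j : Fin (n - 1)) : ℝ :=
  -((xiSeq l u n x ((j : ℕ) + 1)) ^ p + (p - 1) * (xiSeq l u n x ((j : ℕ) + 2)) ^ p
      - p * (xiSeq l u n x ((j : ℕ) + 1)) * (xiSeq l u n x ((j : ℕ) + 2)) ^ (p - 1))
    / ((xiSeq l u n x ((j : ℕ) + 2)) ^ (p - 1) - (xiSeq l u n x ((j : ℕ) + 1)) ^ (p - 1))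
  + ((xiSeq l u n x ((j : ℕ) + 1)) ^ p + (p - 1) * (xiSeq l u n x (j : ℕ)) ^ p
      - p * (xiSeq l u n x ((j : ℕ) + 1)) * (xiSeq l u n x (j : ℕ)) ^ (p - 1))
    / ((xiSeq l u n x ((j : ℕ) + 1)) ^ (p - 1) - (xiSeq l u n x (j : ℕ)) ^ (p - 1))

/-- The Jacobian matrix `J(ξ) = [∂F_i/∂ξ_j]` of the map `F` at `x`. -/
noncomputable def Jmat (l u p : ℝ) (n : ℕ) (x : Fin (n - 1) → ℝ) :
    Matrix (Fin (n - 1)) (Fin (n - 1)) ℝ :=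
  Matrix.of fun i j => fderiv ℝ (fun y => Fmap l u p n y i) x (Pi.single j 1)

/-- The weighted centroid of `[a,b]` with density `t^(p-2)`. -/
noncomputable def mu (p a b : ℝ) : ℝ :=
  if a = b then a else (p - 1) / p * ((b ^ p - a ^ p) / (b ^ (p - 1) - a ^ (p - 1)))

lemma mu_self (p a : ℝ) : mu p a a = a := by simp [mu]

lemma mu_comm (p a b : ℝ) : mu p a b = mu p b a := by
  unfold mu
  by_cases h : a = b
  · simp [h]
  · rw [if_neg h, if_neg (Ne.symm h), ← neg_sub (b ^ p), ← neg_sub (b ^ (p - 1)), neg_div_neg_eq]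

lemma rpow_tangent {p x y : ℝ} (hp : 2 < p) (hx : 0 ≤ x) (hy : 0 ≤ y) (hxy : x ≠ y) :
    0 < y ^ p + (p - 1) * x ^ p - p * y * x ^ (p - 1) := by
  rcases hx.eq_or_lt with h0 | hx0
  · subst h0
    have hy0 : 0 < y := lt_of_le_of_ne hy hxy
    rw [Real.zero_rpow (by linarith), Real.zero_rpow (by linarith)]
    have := Real.rpow_pos_of_pos hy0 p
    linarith
  · have hb := one_add_mul_self_lt_rpow_one_add (s := y / x - 1) (p := p)
      (by have : 0 ≤ y / x := by positivity
          linarith)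
      (by intro h
          apply hxy
          have : y / x = 1 := by linarith
          field_simp at this
          exact this.symm) (by linarith)
    have e : 1 + (y / x - 1) = y / x := by ring
    rw [e, Real.div_rpow hy hx] at hb
    have hxp : 0 < x ^ p := Real.rpow_pos_of_pos hx0 p
    have h1 : x ^ (p - 1) = x ^ p / x := Real.rpow_sub_one hx0.ne' p
    rw [h1]
    rw [lt_div_iff₀ hxp] at hb
    have : y ^ p + (p - 1) * x ^ p - p * y * (x ^ p / x)
      = y ^ p - (1 + p * (y / x - 1)) * x ^ p := by field_simp; ring
    rw [this]; linarith

lemma W_pos {p a b : ℝ} (hp : 2 < p) (ha : 0 ≤ a) (hab : a < b) :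
    0 < b ^ (p - 1) - a ^ (p - 1) :=
  sub_pos.2 (Real.rpow_lt_rpow ha hab (by linarith))

lemma mu_mul {p a b : ℝ} (hp : 2 < p) (ha : 0 ≤ a) (hab : a < b) :
    p * mu p a b * (b ^ (p - 1) - a ^ (p - 1)) = (p - 1) * (b ^ p - a ^ p) := by
  have := W_pos hp ha hab
  rw [mu, if_neg hab.ne]
  have hp0 : p ≠ 0 := by linarith
  field_simp

lemma pow_split {p a : ℝ} (hp : 2 < p) (ha : 0 ≤ a) : a ^ p = a * a ^ (p - 1) := by
  have h := Real.rpow_add_one' (x := a) (y := p - 1) ha (by linarith)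
  rw [sub_add_cancel] at h
  rw [h, mul_comm]

lemma A_eq {p a b : ℝ} (hp : 2 < p) (ha : 0 ≤ a) (hab : a < b) :
    (a ^ p + (p - 1) * b ^ p - p * a * b ^ (p - 1)) / (b ^ (p - 1) - a ^ (p - 1))
      = p * (mu p a b - a) := by
  have hW := W_pos hp ha hab
  rw [div_eq_iff hW.ne']
  have := mu_mul hp ha hab
  have := pow_split hp ha
  linear_combination (-1) * mu_mul hp ha hab + p * pow_split hp ha

lemma B_eq {p a b : ℝ} (hp : 2 < p) (ha : 0 ≤ a) (hab : a < b) :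
    (b ^ p + (p - 1) * a ^ p - p * b * a ^ (p - 1)) / (b ^ (p - 1) - a ^ (p - 1))
      = p * (b - mu p a b) := by
  have hW := W_pos hp ha hab
  rw [div_eq_iff hW.ne']
  linear_combination mu_mul hp ha hab + p * pow_split hp (ha.trans hab.le)

lemma lt_mu {p a b : ℝ} (hp : 2 < p) (ha : 0 ≤ a) (hab : a < b) : a < mu p a b := by
  have h := A_eq hp ha hab
  have h2 := div_pos (rpow_tangent hp (ha.trans hab.le) ha hab.ne') (W_pos hp ha hab)
  rw [h] at h2
  have := (mul_pos_iff_of_pos_left (by linarith : 0 < p)).1 h2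
  linarith

lemma mu_lt {p a b : ℝ} (hp : 2 < p) (ha : 0 ≤ a) (hab : a < b) : mu p a b < b := by
  have h := B_eq hp ha hab
  have h2 := div_pos (rpow_tangent hp ha (ha.trans hab.le) hab.ne) (W_pos hp ha hab)
  rw [h] at h2
  have := (mul_pos_iff_of_pos_left (by linarith : 0 < p)).1 h2
  linarith

lemma mu_three {p x y z : ℝ} (hp : 2 < p) (hx : 0 ≤ x) (hxy : x < y) (hyz : y < z) :
    mu p x y < mu p x z ∧ mu p x z < mu p y z := by
  have hy := hx.trans hxy.le
  have h1 := mu_mul hp hx hxy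
  have h2 := mu_mul hp hy hyz
  have h3 := mu_mul hp hx (hxy.trans hyz)
  have w1 := W_pos hp hx hxy
  have w2 := W_pos hp hy hyz
  have l1 := mu_lt hp hx hxy
  have l2 := lt_mu hp hy hyz
  have hp0 : 0 < p := by linarith
  set A := mu p x y
  set B := mu p y z
  set C := mu p x z
  set U := y ^ (p - 1) - x ^ (p - 1) with hU
  set V := z ^ (p - 1) - y ^ (p - 1) with hV
  have e : z ^ (p - 1) - x ^ (p - 1) = U + V := by rw [hU, hV]; ring
  rw [e] at h3
  have key : p * (C * (U + V)) = p * (A * U + B * V) := by linear_combination h3 - h1 - h2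
  have key := mul_left_cancel₀ hp0.ne' key
  have hAB : A < B := l1.trans l2
  constructor
  · by_contra! hc
    nlinarith [mul_le_mul_of_nonneg_right hc (by linarith : 0 ≤ U + V), mul_lt_mul_of_pos_right hAB w2]
  · by_contra! hc
    nlinarith [mul_le_mul_of_nonneg_right hc (by linarith : 0 ≤ U + V), mul_lt_mul_of_pos_right hAB w1]

lemma mu_mono_right {p a b b' : ℝ} (hp : 2 < p) (ha : 0 ≤ a) (hb : 0 ≤ b) (h : b ≤ b') :
    mu p a b ≤ mu p a b' := by
  rcases h.eq_or_lt with rfl | h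
  · rfl
  rcases lt_trichotomy a b with h1 | rfl | h1
  · exact (mu_three hp ha h1 h).1.le
  · rw [mu_self]; exact (lt_mu hp ha h).le
  rw [mu_comm p a b]
  rcases lt_trichotomy a b' with h2 | rfl | h2
  · exact (mu_lt hp hb h1).le.trans (lt_mu hp ha h2).le
  · rw [mu_self]; exact (mu_lt hp hb h1).le
  · rw [mu_comm p a b']
    exact (mu_three hp hb h h2).2.le

lemma mu_mono {p a b a' b' : ℝ} (hp : 2 < p) (ha : 0 ≤ a) (hb : 0 ≤ b) (h : a ≤ a')
    (h' : b ≤ b') : mu p a b ≤ mu p a' b' := by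
  refine (mu_mono_right hp ha hb h').trans ?_
  rw [mu_comm p a, mu_comm p a']
  exact mu_mono_right hp (hb.trans h') ha h

lemma int_formula {p c d m : ℝ} (hp : 2 < p) (hc0 : 0 ≤ c) (hd0 : 0 ≤ d) :
    p * (p - 1) * ∫ t in c..d, (t - m) * t ^ (p - 2) =
      (p - 1) * (d ^ p - c ^ p) - p * m * (d ^ (p - 1) - c ^ (p - 1)) := by
  have hc : Continuous fun t : ℝ => (t - m) * t ^ (p - 2) :=
    (continuous_id.sub continuous_const).mul (Real.continuous_rpow_const (by linarith))
  have hD : ∀ t : ℝ, HasDerivAt (fun t : ℝ => t * t ^ (p - 1) / p - m * (t ^ (p - 1) / (p - 1)))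
      ((t - m) * t ^ (p - 2)) t := by
    intro t
    have h1 := Real.hasDerivAt_rpow_const (x := t) (p := p - 1) (Or.inr (by linarith))
    have h2 := (((hasDerivAt_id t).mul h1).div_const p).sub ((h1.div_const (p - 1)).const_mul m)
    have e : t ^ (p - 1) = t ^ (p - 2) * t := by
      rcases eq_or_ne t 0 with rfl | ht
      · rw [Real.zero_rpow (by linarith), mul_zero]
      · rw [← Real.rpow_add_one ht]; congr 1; ring
    have e' : p - 1 - 1 = p - 2 := by ring
    refine HasDerivAt.congr_deriv h2 ?_
    rw [e', e]
    have hp0 : p ≠ 0 := by linarith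
    have hp1 : p - 1 ≠ 0 := by linarith
    simp only [id]
    field_simp
    ring
  rw [intervalIntegral.integral_eq_sub_of_hasDerivAt (fun t _ => hD t) (hc.intervalIntegrable _ _)]
  have hp0 : p ≠ 0 := by linarith
  have hp1 : p - 1 ≠ 0 := by linarith
  rw [pow_split hp hc0, pow_split hp hd0]
  field_simp
  ring

lemma mu_shift {p a b d : ℝ} (hp : 2 < p) (ha : 0 ≤ a) (hab : a < b) (hd : 0 ≤ d) :
    mu p (a + d) (b + d) ≤ mu p a b + d := by
  set m := mu p a b with hm
  have hm0 : 0 < m := lt_of_le_of_lt ha (lt_mu hp ha hab)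
  have hc : Continuous fun t : ℝ => t ^ (p - 2) :=
    Real.continuous_rpow_const (by linarith)
  have i0 : ∫ t in a..b, (t - m) * t ^ (p - 2) = 0 := by
    have h := int_formula (p := p) (c := a) (d := b) (m := m) hp ha (ha.trans hab.le)
    rw [← mu_mul hp ha hab, ← hm, sub_self] at h
    have : p * (p - 1) ≠ 0 := by
      have : 0 < p * (p - 1) := mul_pos (by linarith) (by linarith)
      exact this.ne'
    exact (mul_eq_zero.1 h).resolve_left this
  have i1 : ∫ t in a..b, m ^ (p - 2) * ((t - m) * (t + d) ^ (p - 2))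
      ≤ ∫ t in a..b, (m + d) ^ (p - 2) * ((t - m) * t ^ (p - 2)) := by
    apply intervalIntegral.integral_mono_on hab.le
    · apply Continuous.intervalIntegrable
      have := hc.comp (continuous_add_const d)
      exact continuous_const.mul ((continuous_id.sub continuous_const).mul this)
    · apply Continuous.intervalIntegrable
      exact continuous_const.mul ((continuous_id.sub continuous_const).mul hc)
    · intro t ht
      have ht0 : 0 ≤ t := ha.trans ht.1
      have f1 : m ^ (p - 2) * (t + d) ^ (p - 2) = (m * (t + d)) ^ (p - 2) :=
        (Real.mul_rpow hm0.le (by linarith)).symm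
      have f2 : (m + d) ^ (p - 2) * t ^ (p - 2) = ((m + d) * t) ^ (p - 2) :=
        (Real.mul_rpow (by linarith) ht0).symm
      have g1 : m ^ (p - 2) * ((t - m) * (t + d) ^ (p - 2)) = (t - m) * (m * (t + d)) ^ (p - 2) := by
        rw [← f1]; ring
      have g2 : (m + d) ^ (p - 2) * ((t - m) * t ^ (p - 2)) = (t - m) * ((m + d) * t) ^ (p - 2) := by
        rw [← f2]; ring
      rw [g1, g2]
      rcases le_total t m with h | h
      · apply mul_le_mul_of_nonpos_left _ (by linarith)
        apply Real.rpow_le_rpow (by positivity) _ (by linarith)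
        nlinarith
      · apply mul_le_mul_of_nonneg_left _ (by linarith)
        apply Real.rpow_le_rpow (by positivity) _ (by linarith)
        nlinarith
  rw [intervalIntegral.integral_const_mul, intervalIntegral.integral_const_mul, i0, mul_zero] at i1
  have hmp : 0 < m ^ (p - 2) := Real.rpow_pos_of_pos hm0 _
  have i2 : ∫ t in a..b, (t - m) * (t + d) ^ (p - 2) ≤ 0 := by
    by_contra! h
    exact absurd i1 (not_le.2 (mul_pos hmp h))
  have i3 : ∫ t in a..b, (t - m) * (t + d) ^ (p - 2)
      = ∫ t in (a + d)..(b + d), (t - (m + d)) * t ^ (p - 2) := by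
    rw [← intervalIntegral.integral_comp_add_right
      (fun t => (t - (m + d)) * t ^ (p - 2)) d]
    congr 1; ext t; ring
  rw [i3] at i2
  have had : 0 ≤ a + d := by linarith
  have habd : a + d < b + d := by linarith
  have h := int_formula (p := p) (c := a + d) (d := b + d) (m := m + d) hp had (had.trans habd.le)
  rw [← mu_mul hp had habd] at h
  have hW := W_pos hp had habd
  have hpp : 0 < p * (p - 1) := mul_pos (by linarith) (by linarith)
  have h5 := mul_nonpos_of_nonneg_of_nonpos hpp.le i2
  rw [h] at h5
  by_contra! hcon
  have : 0 < p * (mu p (a + d) (b + d) - (m + d)) * ((b + d) ^ (p - 1) - (a + d) ^ (p - 1)) :=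
    mul_pos (mul_pos (by linarith) (by linarith)) hW
  linarith

lemma xi_zero (l u : ℝ) (n : ℕ) (x : Fin (n - 1) → ℝ) : xiSeq l u n x 0 = l := by
  simp [xiSeq]

lemma xi_n (l u : ℝ) (n : ℕ) (hn : 2 ≤ n) (x : Fin (n - 1) → ℝ) : xiSeq l u n x n = u := by
  have : n ≠ 0 := by omega
  simp [xiSeq, this]

lemma xi_succ (l u : ℝ) (n : ℕ) (x : Fin (n - 1) → ℝ) (j : Fin (n - 1)) :
    xiSeq l u n x (j + 1) = x j := by
  have : (j : ℕ) + 1 < n := by omega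
  simp [xiSeq, this]

lemma xi_mono (l u : ℝ) (n : ℕ) {x y : Fin (n - 1) → ℝ} (h : x ≤ y) (i : ℕ) :
    xiSeq l u n x i ≤ xiSeq l u n y i := by
  unfold xiSeq
  split_ifs
  · exact h _
  · rfl
  · rfl

lemma xi_mem {l u : ℝ} (hlu : l ≤ u) (n : ℕ) {x : Fin (n - 1) → ℝ}
    (h : ∀ j, x j ∈ Set.Icc l u) (i : ℕ) : xiSeq l u n x i ∈ Set.Icc l u := by
  unfold xiSeq
  split_ifs
  · exact h _
  · exact ⟨le_rfl, hlu⟩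
  · exact ⟨hlu, le_rfl⟩

lemma dom_ge {l u : ℝ} {n : ℕ} {x : Fin (n - 1) → ℝ} (h : x ∈ domD l u n) :
    ∀ i ≤ n, l ≤ xiSeq l u n x i := by
  intro i
  induction i with
  | zero => intro _; rw [xi_zero]
  | succ k ih => intro hk; exact (ih (by omega)).trans (h k (by omega)).le

lemma F_zero_iff {l u p : ℝ} (hl : 0 ≤ l) {n : ℕ} (hp : 2 < p) {x : Fin (n - 1) → ℝ}
    (h : x ∈ domD l u n) (j : Fin (n - 1)) :
    Fmap l u p n x j = 0 ↔ 2 * xiSeq l u n x (j + 1) =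
      mu p (xiSeq l u n x j) (xiSeq l u n x (j + 1))
      + mu p (xiSeq l u n x (j + 1)) (xiSeq l u n x (j + 2)) := by
  have hj := j.2
  have d1 := h j (by omega)
  have d2 := h (j + 1) (by omega)
  have g0 := hl.trans (dom_ge h j (by omega))
  have g1 := g0.trans d1.le
  unfold Fmap
  rw [neg_div, A_eq hp g1 d2, B_eq hp g0 d1]
  constructor
  · intro e
    have hp0 : p ≠ 0 := by linarith
    apply mul_left_cancel₀ hp0
    linear_combination e
  · intro e
    linear_combination p * e

lemma uniq_le {l u p : ℝ} (hl : 0 ≤ l) {n : ℕ} (hn : 2 ≤ n) (hp : 2 < p)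
    {x y : Fin (n - 1) → ℝ} (hx : x ∈ domD l u n) (hy : y ∈ domD l u n)
    (ex : ∀ i, Fmap l u p n x i = 0) (ey : ∀ i, Fmap l u p n y i = 0) :
    ∀ i ≤ n, xiSeq l u n y i ≤ xiSeq l u n x i := by
  set d : ℕ → ℝ := fun i => xiSeq l u n y i - xiSeq l u n x i with hd
  obtain ⟨k, hk, hmax⟩ := Finset.exists_max_image (Finset.range (n + 1)) d ⟨0, by simp⟩
  by_contra! hcon
  obtain ⟨i0, hi0, hi0'⟩ := hcon
  have hM : 0 < d k := by
    have := hmax i0 (by simp; omega)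
    simp only [hd] at this ⊢
    linarith
  set M := d k with hMdef
  have hex : ∃ i, i ≤ n ∧ d i = M := ⟨k, by simpa [Nat.lt_succ_iff] using hk, rfl⟩
  classical
  obtain ⟨hi1, hi2⟩ := Nat.find_spec hex
  have hmin : ∀ j, j < Nat.find hex → j ≤ n → d j ≠ M := fun j hj hjn he =>
    Nat.find_min hex hj ⟨hjn, he⟩
  set i := Nat.find hex
  have hi_ne0 : i ≠ 0 := by
    intro h
    rw [h] at hi2
    simp only [hd, xi_zero] at hi2
    linarith
  have hi_nen : i ≠ n := by
    intro h
    rw [h] at hi2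
    simp only [hd, xi_n l u n hn] at hi2
    linarith
  obtain ⟨j, hj⟩ : ∃ j, i = j + 1 := ⟨i - 1, by omega⟩
  rw [hj] at hi1 hi2 hi_nen hmin
  have hjn : j < n - 1 := by omega
  have q1 := (F_zero_iff hl hp hx ⟨j, hjn⟩).1 (ex _)
  have q2 := (F_zero_iff hl hp hy ⟨j, hjn⟩).1 (ey _)
  simp only at q1 q2
  have dx1 := hx j (by omega)
  have dx2 := hx (j + 1) (by omega)
  have dy1 := hy j (by omega)
  have dy2 := hy (j + 1) (by omega)
  have gx := hl.trans (dom_ge hx j (by omega))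
  have gy := hl.trans (dom_ge hy j (by omega))
  have m0 : d j < M := lt_of_le_of_ne (hmax j (by simp; omega)) (hmin j (by omega) (by omega))
  have m2 : d (j + 2) ≤ M := hmax (j + 2) (by simp; omega)
  simp only [hd] at m0 m2 hi2
  rw [add_assoc] at dx2 dy2
  norm_num at dx2 dy2
  have e1 : xiSeq l u n y (j + 1) = xiSeq l u n x (j + 1) + M := by linarith
  rw [e1] at q2 dy1 dy2
  have s1 : mu p (xiSeq l u n y j) (xiSeq l u n x (j + 1) + M)
      < mu p (xiSeq l u n x j + M) (xiSeq l u n x (j + 1) + M) :=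
    (mu_three hp gy (by linarith) (by linarith)).2
  have s2 : mu p (xiSeq l u n x (j + 1) + M) (xiSeq l u n y (j + 2))
      ≤ mu p (xiSeq l u n x (j + 1) + M) (xiSeq l u n x (j + 2) + M) :=
    mu_mono_right hp (by linarith) (by linarith) (by linarith)
  have s3 := mu_shift hp gx dx1 hM.le
  have s4 := mu_shift hp (gx.trans dx1.le) dx2 hM.le
  linarith

lemma mu_mem {l u p a b : ℝ} (hl : 0 ≤ l) (hp : 2 < p) (ha : a ∈ Set.Icc l u)
    (hb : b ∈ Set.Icc l u) : mu p a b ∈ Set.Icc l u := by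
  constructor
  · have := mu_mono hp hl hl ha.1 hb.1
    rwa [mu_self] at this
  · have := mu_mono hp (hl.trans ha.1) (hl.trans hb.1) ha.2 hb.2
    rwa [mu_self] at this

lemma exists_fix {l u p : ℝ} (hl : 0 ≤ l) (hlu : l < u) (n : ℕ) (hp : 2 < p) :
    ∃ x : Fin (n - 1) → ℝ, (∀ j, x j ∈ Set.Icc l u) ∧ ∀ j : Fin (n - 1),
      2 * xiSeq l u n x (j + 1) =
      mu p (xiSeq l u n x j) (xiSeq l u n x (j + 1))
      + mu p (xiSeq l u n x (j + 1)) (xiSeq l u n x (j + 2)) := by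
  have : Fact (l ≤ u) := ⟨hlu.le⟩
  have hm := fun (x : Fin (n - 1) → Set.Icc l u) =>
    xi_mem hlu.le n (x := fun j => (x j : ℝ)) (fun j => (x j).2)
  let T : (Fin (n - 1) → Set.Icc l u) →o (Fin (n - 1) → Set.Icc l u) :=
    { toFun := fun x j => ⟨(mu p (xiSeq l u n (fun j => (x j : ℝ)) j)
          (xiSeq l u n (fun j => (x j : ℝ)) (j + 1))
        + mu p (xiSeq l u n (fun j => (x j : ℝ)) (j + 1))
          (xiSeq l u n (fun j => (x j : ℝ)) (j + 2))) / 2, by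
          have h1 := mu_mem hl hp (hm x j) (hm x (j + 1))
          have h2 := mu_mem hl hp (hm x (j + 1)) (hm x (j + 2))
          exact ⟨by linarith [h1.1, h2.1], by linarith [h1.2, h2.2]⟩⟩
      monotone' := by
        intro x y hxy j
        have hxy' : (fun j => (x j : ℝ)) ≤ (fun j => (y j : ℝ)) := fun j => hxy j
        have h0 := fun i => xi_mono l u n hxy' i
        have hp0 := fun i => hl.trans (hm x i).1
        rw [← Subtype.coe_le_coe]
        have a1 := mu_mono hp (hp0 j) (hp0 (j + 1)) (h0 j) (h0 (j + 1))
        have a2 := mu_mono hp (hp0 (j + 1)) (hp0 (j + 2)) (h0 (j + 1)) (h0 (j + 2))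
        simp only
        linarith }
  have hfix := T.map_lfp
  set x := OrderHom.lfp T
  refine ⟨fun j => (x j : ℝ), fun j => (x j).2, fun j => ?_⟩
  have : (mu p (xiSeq l u n (fun j => (x j : ℝ)) j)
          (xiSeq l u n (fun j => (x j : ℝ)) (j + 1))
        + mu p (xiSeq l u n (fun j => (x j : ℝ)) (j + 1))
          (xiSeq l u n (fun j => (x j : ℝ)) (j + 2))) / 2 = (x j : ℝ) :=
    congrArg Subtype.val (congrFun hfix j)
  rw [xi_succ] at this ⊢
  linarith

lemma fix_dom {l u p : ℝ} (hl : 0 ≤ l) (hlu : l < u) {n : ℕ} (hn : 2 ≤ n) (hp : 2 < p)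
    {x : Fin (n - 1) → ℝ} (hx : ∀ j, x j ∈ Set.Icc l u) (hf : ∀ j : Fin (n - 1),
      2 * xiSeq l u n x (j + 1) =
      mu p (xiSeq l u n x j) (xiSeq l u n x (j + 1))
      + mu p (xiSeq l u n x (j + 1)) (xiSeq l u n x (j + 2))) : x ∈ domD l u n := by
  have hs := fun i => hl.trans (xi_mem hlu.le n hx i).1
  have hn0 := xi_n l u n hn x
  have h0 := xi_zero l u n x
  set s := xiSeq l u n x with hsdef
  have hf' : ∀ j, j + 1 < n → 2 * s (j + 1) = mu p (s j) (s (j + 1)) + mu p (s (j + 1)) (s (j + 2)) :=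
    fun j hj => hf ⟨j, by omega⟩
  by_cases h01 : s 0 < s 1
  · intro i hi
    show s i < s (i + 1)
    induction i with
    | zero => exact h01
    | succ k ih =>
      have h1 := ih (by omega)
      have h2 := mu_lt hp (hs k) h1
      have h3 := hf' k hi
      by_contra! hc
      have h4 := mu_mono_right hp (hs (k + 1)) (hs (k + 2)) hc
      rw [mu_self] at h4
      linarith
  · exfalso
    have key : ∀ i < n, s (i + 1) ≤ s i := by
      intro i hi
      induction i with
      | zero => exact not_lt.1 h01
      | succ k ih =>
        have h1 := ih (by omega)
        have h2 := mu_mono hp (hs (k + 1)) (hs (k + 1)) h1 le_rfl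
        rw [mu_self] at h2
        have h3 := hf' k hi
        by_contra! hc
        have h4 := lt_mu hp (hs (k + 1)) hc
        have : s (k + 1 + 1) = s (k + 2) := rfl
        rw [this] at h4
        linarith
    have k2 : ∀ i ≤ n, s i ≤ l := by
      intro i
      induction i with
      | zero => intro _; exact h0.le
      | succ k ih => intro hk; exact (key k (by omega)).trans (ih (by omega))
    have := k2 n le_rfl
    linarith

/-- For `p > 2`, there is a unique `ξ ∈ D` with `F(ξ) = 0`. -/
theorem unique_stationary_point_of_two_lt_p
    (l u : ℝ) (hl : 0 ≤ l) (hlu : l < u) (n : ℕ) (hn : 2 ≤ n) (p : ℝ) (hp : 2 < p) :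
    ∃! x : Fin (n - 1) → ℝ, x ∈ domD l u n ∧ ∀ i, Fmap l u p n x i = 0 := by
  obtain ⟨x, hx, hf⟩ := exists_fix hl hlu n hp
  have hxd := fix_dom hl hlu hn hp hx hf
  have hF : ∀ i, Fmap l u p n x i = 0 := fun j => (F_zero_iff hl hp hxd j).2 (hf j)
  refine ⟨x, ⟨hxd, hF⟩, ?_⟩
  rintro y ⟨hyd, hyF⟩
  funext j
  have h1 := uniq_le hl hn hp hxd hyd hF hyF (j + 1) (by omega)
  have h2 := uniq_le hl hn hp hyd hxd hyF hF (j + 1) (by omega)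
  rw [xi_succ, xi_succ] at h1 h2
  exact le_antisymm h1 h2
end
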